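/- Let b ∈ (1/2, 1) and set β = exp(−2πi·b) (so β ∉ {1, −1}). Then there exist matrices A₀, A₁, A₄, A_∞ ∈ GL₄(ℂ) such that: (i) A₀·A₁·A₄·A_∞ = I; (ii) A₀ and A₄ are each conjugate in GL₄(ℂ) to diag(J₂(1), 1, 1); (iii) A₁ is conjugate to diag(J₂(−1), 1, 1); (iv) A_∞ is conjugate to the diagonal matrix diag(β, β, β⁻¹, β⁻¹); (v) the tuple (A₀, A₁, A₄, A_∞) is irreducible; (vi) there exists an invertible matrix S ∈ GL₄(ℂ) with Sᵀ = −S and AᵀSA = S for each A ∈ {A₀, A₁, A₄, A_∞}. -/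

import Mathlib

/-!
Statement 4: existence of the monodromy tuple of the rigid local system 𝒫₁₃
(case α = −1, β ≠ −1), with symplectic monodromy group.
-/

open Matrix

/-- Two square matrices are conjugate (by an invertible matrix). -/
def MatConj {n : ℕ} (A B : Matrix (Fin n) (Fin n) ℂ) : Prop :=
  ∃ C : Matrix (Fin n) (Fin n) ℂ, IsUnit C ∧ C * A * C⁻¹ = B

/-- A set of matrices acts irreducibly on ℂⁿ: the only common invariant
subspaces are `⊥` and `⊤`. -/
def MatIrred {n : ℕ} (s : Set (Matrix (Fin n) (Fin n) ℂ)) : Prop :=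
  ∀ W : Submodule ℂ (Fin n → ℂ), (∀ A ∈ s, ∀ v ∈ W, A.mulVec v ∈ W) → W = ⊥ ∨ W = ⊤

/-- A square matrix `A` is conjugate to `J` as soon as `A * Y = Y * J` with `Y` invertible. -/
theorem MatConj.of_mul_eq_mul {n : ℕ} {A J : Matrix (Fin n) (Fin n) ℂ}
    (Y : Matrix (Fin n) (Fin n) ℂ) (hY : Y.det ≠ 0) (h : A * Y = Y * J) : MatConj A J := by
  have hu : IsUnit Y.det := hY.isUnit
  refine ⟨Y⁻¹, (Matrix.isUnit_nonsing_inv_iff).2 ((Matrix.isUnit_iff_isUnit_det Y).2 hu), ?_⟩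
  rw [Matrix.nonsing_inv_nonsing_inv Y hu, Matrix.mul_assoc, h, ← Matrix.mul_assoc,
    Matrix.nonsing_inv_mul Y hu, Matrix.one_mul]

namespace SymplecticTuple

/-- The standard alternating form on `ℂ⁴`. -/
def form : Matrix (Fin 4) (Fin 4) ℂ :=
  !![0, 0, 1, 0; 0, 0, 0, 1; -1, 0, 0, 0; 0, -1, 0, 0]

/-- The map `v ↦ v + c ω(u, v) u`, where `ω` is given by `form`. -/
def symTransvection (c : ℂ) (u : Fin 4 → ℂ) : Matrix (Fin 4) (Fin 4) ℂ :=
  1 + c • vecMulVec u (u ᵥ* form)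

/-- The centre of the transvection used as local monodromy at `0`. -/
def u (β : ℂ) : Fin 4 → ℂ := ![1, 0, β - 1, -2 * β]

/-- The centre of the transvection used as local monodromy at `4`. -/
def w (β : ℂ) : Fin 4 → ℂ := ![0, 1, 2, β - 1]

/-- The diagonal matrix with entries `β, β, β⁻¹, β⁻¹`. -/
noncomputable def diagPair (β : ℂ) : Matrix (Fin 4) (Fin 4) ℂ :=
  !![β, 0, 0, 0; 0, β, 0, 0; 0, 0, β⁻¹, 0; 0, 0, 0, β⁻¹]

theorem form_transpose : formᵀ = -form := by
  ext i j; fin_cases i <;> fin_cases j <;> simp [form]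

theorem form_det : form.det = 1 := by
  simp [form, det_succ_row_zero, Fin.sum_univ_succ, Fin.succAbove]

theorem vecMul_form (x : Fin 4 → ℂ) : x ᵥ* form = ![-x 2, -x 3, x 0, x 1] := by
  ext i
  fin_cases i <;> simp [form, Matrix.vecMul_eq_sum, Fin.sum_univ_succ]

theorem vecMul_form_dotProduct (x y : Fin 4 → ℂ) :
    (x ᵥ* form) ⬝ᵥ y = x 0 * y 2 + x 1 * y 3 - x 2 * y 0 - x 3 * y 1 := by
  rw [vecMul_form]
  simp [dotProduct, Fin.sum_univ_succ]
  ring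

theorem transvection_mulVec (c : ℂ) (x v : Fin 4 → ℂ) :
    symTransvection c x *ᵥ v = v + (c * ((x ᵥ* form) ⬝ᵥ v)) • x := by
  simp [symTransvection, add_mulVec, smul_mulVec, vecMulVec_mulVec, smul_smul]

theorem transvection_apply (c : ℂ) (x : Fin 4 → ℂ) :
    symTransvection c x = !![1 - c * x 0 * x 2, -c * x 0 * x 3, c * x 0 * x 0, c * x 0 * x 1;
      -c * x 1 * x 2, 1 - c * x 1 * x 3, c * x 1 * x 0, c * x 1 * x 1;
      -c * x 2 * x 2, -c * x 2 * x 3, 1 + c * x 2 * x 0, c * x 2 * x 1;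
      -c * x 3 * x 2, -c * x 3 * x 3, c * x 3 * x 0, 1 + c * x 3 * x 1] := by
  ext i j
  fin_cases i <;> fin_cases j <;>
    simp [symTransvection, vecMul_form] <;> ring

theorem transvection_mul_neg (c : ℂ) (x : Fin 4 → ℂ) :
    symTransvection c x * symTransvection (-c) x = 1 := by
  rw [transvection_apply, transvection_apply]
  ext i j
  fin_cases i <;> fin_cases j <;> simp [Matrix.mul_apply, Fin.sum_univ_succ] <;> ring

theorem transvection_neg_mul (c : ℂ) (x : Fin 4 → ℂ) :
    symTransvection (-c) x * symTransvection c x = 1 :=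
  mul_eq_one_comm.1 (transvection_mul_neg c x)

theorem transvection_preserves (c : ℂ) (x : Fin 4 → ℂ) :
    (symTransvection c x)ᵀ * form * symTransvection c x = form := by
  rw [transvection_apply]
  ext i j
  fin_cases i <;> fin_cases j <;> simp [form, Matrix.mul_apply, Fin.sum_univ_succ] <;> ring

theorem diagPair_mul_diagPair_inv {β : ℂ} (h : β ≠ 0) : diagPair β * diagPair β⁻¹ = 1 := by
  ext i j
  fin_cases i <;> fin_cases j <;> simp [diagPair, Matrix.mul_apply, Fin.sum_univ_succ, h]

theorem diagPair_inv_mul_diagPair {β : ℂ} (h : β ≠ 0) : diagPair β⁻¹ * diagPair β = 1 :=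
  mul_eq_one_comm.1 (diagPair_mul_diagPair_inv h)

theorem diagPair_preserves {β : ℂ} (h : β ≠ 0) : (diagPair β)ᵀ * form * diagPair β = form := by
  ext i j
  fin_cases i <;> fin_cases j <;> simp [diagPair, form, Matrix.mul_apply, Fin.sum_univ_succ, h]

theorem preserves_mul {A B : Matrix (Fin 4) (Fin 4) ℂ} (hA : Aᵀ * form * A = form)
    (hB : Bᵀ * form * B = form) : (A * B)ᵀ * form * (A * B) = form := by
  calc (A * B)ᵀ * form * (A * B) = Bᵀ * (Aᵀ * form * A) * B := by
        simp only [transpose_mul, Matrix.mul_assoc]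
    _ = form := by rw [hA, hB]

/-- The local monodromy at `1`. -/
noncomputable def middle (β : ℂ) : Matrix (Fin 4) (Fin 4) ℂ :=
  symTransvection (-(1 + β)⁻¹) (u β) * diagPair β⁻¹ * symTransvection (-(1 + β)⁻¹) (w β)

theorem product_eq_one {β : ℂ} (h : β ≠ 0) :
    symTransvection (1 + β)⁻¹ (u β) * middle β * symTransvection (1 + β)⁻¹ (w β) *
      diagPair β = 1 := by
  calc _ = (symTransvection (1 + β)⁻¹ (u β) * symTransvection (-(1 + β)⁻¹) (u β)) * diagPair β⁻¹ *
        (symTransvection (-(1 + β)⁻¹) (w β) * symTransvection (1 + β)⁻¹ (w β)) * diagPair β := by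
        simp only [middle, Matrix.mul_assoc]
    _ = 1 := by
        rw [transvection_mul_neg, transvection_neg_mul, Matrix.one_mul, Matrix.mul_one,
          diagPair_inv_mul_diagPair h]

theorem matConj_transvection_u {β : ℂ} (h : 1 + β ≠ 0) :
    MatConj (symTransvection (1 + β)⁻¹ (u β))
      !![1, 1, 0, 0; 0, 1, 0, 0; 0, 0, 1, 0; 0, 0, 0, 1] := by
  refine .of_mul_eq_mul !![(1 + β)⁻¹, 0, 0, 0; 0, 0, 0, 1;
    (1 + β)⁻¹ * (β - 1), 1, 0, -2 * β; (1 + β)⁻¹ * (-2 * β), 0, 1, 0] ?_ ?_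
  · simp [det_succ_row_zero, Fin.sum_univ_succ, Fin.succAbove, h]
  · rw [transvection_apply]
    ext i j
    fin_cases i <;> fin_cases j <;> simp [u, Matrix.mul_apply, Fin.sum_univ_succ] <;> ring

theorem matConj_transvection_w {β : ℂ} (h : 1 + β ≠ 0) :
    MatConj (symTransvection (1 + β)⁻¹ (w β))
      !![1, 1, 0, 0; 0, 1, 0, 0; 0, 0, 1, 0; 0, 0, 0, 1] := by
  refine .of_mul_eq_mul !![0, 0, 0, 1; (1 + β)⁻¹, 0, 0, 0;
    (1 + β)⁻¹ * 2, 0, 1, 0; (1 + β)⁻¹ * (β - 1), 1, 0, 2] ?_ ?_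
  · simp [det_succ_row_zero, Fin.sum_univ_succ, Fin.succAbove, h]
  · rw [transvection_apply]
    ext i j
    fin_cases i <;> fin_cases j <;> simp [w, Matrix.mul_apply, Fin.sum_univ_succ] <;> ring

theorem matConj_middle {β : ℂ} (h0 : β ≠ 0) (h : 1 + β ≠ 0) :
    MatConj (middle β) !![-1, 1, 0, 0; 0, -1, 0, 0; 0, 0, 1, 0; 0, 0, 0, 1] := by
  refine .of_mul_eq_mul !![β, β * (β - 1) / (2 * (1 + β)), β, 0;
    -1, -β / (1 + β), 0, 1;
    -(1 + β), -(1 + β) / 2, 1 - β, -2 * β;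
    -β * (1 + β), 0, 2 * β, -β * (β - 1)] ?_ ?_
  · have hdet : -2 * (β ^ 2 * (1 + β) ^ 2) ≠ 0 := by simp [h0, h]
    convert hdet using 1
    simp [det_succ_row_zero, Fin.sum_univ_succ, Fin.succAbove]
    field_simp
    ring
  · rw [middle, transvection_apply, transvection_apply]
    ext i j
    fin_cases i <;> fin_cases j <;>
      simp [u, w, diagPair, Matrix.mul_apply, Fin.sum_univ_succ] <;> field_simp <;> ring

theorem mem_of_transvection {W : Submodule ℂ (Fin 4 → ℂ)} {c : ℂ} {x v : Fin 4 → ℂ} (hc : c ≠ 0)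
    (hW : ∀ v ∈ W, symTransvection c x *ᵥ v ∈ W) (hv : v ∈ W) (hxv : (x ᵥ* form) ⬝ᵥ v ≠ 0) :
    x ∈ W := by
  have h := W.sub_mem (hW v hv) hv
  rw [transvection_mulVec, add_sub_cancel_left] at h
  exact (W.smul_mem_iff (mul_ne_zero hc hxv)).1 h

theorem projections_mem {W : Submodule ℂ (Fin 4 → ℂ)} {β : ℂ} (h0 : β ≠ 0) (h : β ^ 2 ≠ 1)
    (hW : ∀ v ∈ W, diagPair β *ᵥ v ∈ W) {v : Fin 4 → ℂ} (hv : v ∈ W) :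
    ![v 0, v 1, 0, 0] ∈ W ∧ ![0, 0, v 2, v 3] ∈ W := by
  have hne : β ^ 2 - 1 ≠ 0 := sub_ne_zero.2 h
  have h1 : ![v 0, v 1, 0, 0] ∈ W := by
    have := W.smul_mem (β / (β ^ 2 - 1)) (W.sub_mem (hW v hv) (W.smul_mem β⁻¹ hv))
    convert this using 1
    ext i
    simp only [Pi.smul_apply, Pi.sub_apply, smul_eq_mul]
    fin_cases i <;> simp [diagPair, mulVec, dotProduct, Fin.sum_univ_succ] <;> field_simp
  refine ⟨h1, ?_⟩
  convert W.sub_mem hv h1 using 1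
  ext i
  fin_cases i <;> simp

theorem eq_top_of_mem {W : Submodule ℂ (Fin 4 → ℂ)} {β : ℂ} (h0 : β ≠ 0) (h : β ^ 2 ≠ 1)
    (hW : ∀ v ∈ W, diagPair β *ᵥ v ∈ W) (hu : u β ∈ W) (hw : w β ∈ W) : W = ⊤ := by
  have hne : 1 + β ≠ 0 := fun hz => h (by linear_combination (β - 1) * hz)
  obtain ⟨hp, hq⟩ := projections_mem h0 h hW hu
  obtain ⟨hr, hs⟩ := projections_mem h0 h hW hw
  refine eq_top_iff.2 fun v _ => ?_
  have := W.add_mem (W.add_mem (W.smul_mem (v 0) hp) (W.smul_mem (v 1) hr))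
    (W.add_mem (W.smul_mem (((β - 1) * v 2 - 2 * v 3) / (1 + β) ^ 2) hq)
      (W.smul_mem ((2 * β * v 2 + (β - 1) * v 3) / (1 + β) ^ 2) hs))
  convert this using 1
  ext i
  fin_cases i <;> simp [u, w] <;> field_simp <;> ring

theorem eq_bot_or_eq_top {W : Submodule ℂ (Fin 4 → ℂ)} {β c : ℂ} (h0 : β ≠ 0) (h : β ^ 2 ≠ 1)
    (hc : c ≠ 0) (hu : ∀ v ∈ W, symTransvection c (u β) *ᵥ v ∈ W)
    (hw : ∀ v ∈ W, symTransvection c (w β) *ᵥ v ∈ W) (hD : ∀ v ∈ W, diagPair β *ᵥ v ∈ W) :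
    W = ⊥ ∨ W = ⊤ := by
  have hne : 1 + β ≠ 0 := fun hz => h (by linear_combination (β - 1) * hz)
  have huw : u β ∈ W → w β ∈ W := fun hx =>
    mem_of_transvection hc hw (projections_mem h0 h hD hx).1 (by
      rw [vecMul_form_dotProduct]
      simp [u, w])
  have hwu : w β ∈ W → u β ∈ W := fun hx =>
    mem_of_transvection hc hu (projections_mem h0 h hD hx).1 (by
      rw [vecMul_form_dotProduct]
      simp [u, w, h0])
  by_cases huW : u β ∈ W
  · exact .inr (eq_top_of_mem h0 h hD huW (huw huW))
  by_cases hwW : w β ∈ W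
  · exact .inr (eq_top_of_mem h0 h hD (hwu hwW) hwW)
  refine .inl (W.eq_bot_iff.2 fun v hv => ?_)
  have hou : ∀ v ∈ W, (u β ᵥ* form) ⬝ᵥ v = 0 := fun v hv => by
    by_contra hx
    exact huW (mem_of_transvection hc hu hv hx)
  have how : ∀ v ∈ W, (w β ᵥ* form) ⬝ᵥ v = 0 := fun v hv => by
    by_contra hx
    exact hwW (mem_of_transvection hc hw hv hx)
  obtain ⟨h1, h2⟩ := projections_mem h0 h hD hv
  have e1 := hou _ h1
  have e2 := hou _ h2
  have e3 := how _ h1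
  have e4 := how _ h2
  rw [vecMul_form_dotProduct] at e1 e2 e3 e4
  simp [u, w] at e1 e2 e3 e4
  have hsq : (1 + β) ^ 2 ≠ 0 := pow_ne_zero 2 hne
  have v0 : v 0 = 0 := (mul_eq_zero.1 (by
    linear_combination (1 - β) * e1 - 2 * β * e3 : (1 + β) ^ 2 * v 0 = 0)).resolve_left hsq
  have v1 : v 1 = 0 := (mul_eq_zero.1 (by
    linear_combination 2 * e1 + (1 - β) * e3 : (1 + β) ^ 2 * v 1 = 0)).resolve_left hsq
  ext i
  fin_cases i <;> simp [v0, v1, e2, e4]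

theorem exp_sq_ne_one {b : ℝ} (hb : b ∈ Set.Ioo (1 / 2 : ℝ) 1) :
    Complex.exp (-2 * Real.pi * Complex.I * b) ^ 2 ≠ 1 := by
  rw [← Complex.exp_nat_mul, Ne, Complex.exp_eq_one_iff]
  rintro ⟨n, hn⟩
  have hz : (n : ℂ) = ((-2 * b : ℝ) : ℂ) := by
    refine mul_right_cancel₀ Complex.two_pi_I_ne_zero ?_
    rw [← hn]
    push_cast
    ring
  have hr : (n : ℝ) = -2 * b := by exact_mod_cast hz
  obtain ⟨h1, h2⟩ := hb
  have l1 : (-2 : ℝ) < n := by linarith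
  have l2 : (n : ℝ) < -1 := by linarith
  norm_cast at l1 l2
  omega

end SymplecticTuple

open SymplecticTuple

theorem stmt_4 (b : ℝ) (hb : b ∈ Set.Ioo (1 / 2 : ℝ) 1) (β : ℂ)
    (hβ : β = Complex.exp (-2 * Real.pi * Complex.I * b)) :
    ∃ A0 A1 A4 Ainf : Matrix (Fin 4) (Fin 4) ℂ,
      IsUnit A0 ∧ IsUnit A1 ∧ IsUnit A4 ∧ IsUnit Ainf ∧
      A0 * A1 * A4 * Ainf = 1 ∧
      MatConj A0 !![1, 1, 0, 0; 0, 1, 0, 0; 0, 0, 1, 0; 0, 0, 0, 1] ∧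
      MatConj A4 !![1, 1, 0, 0; 0, 1, 0, 0; 0, 0, 1, 0; 0, 0, 0, 1] ∧
      MatConj A1 !![-1, 1, 0, 0; 0, -1, 0, 0; 0, 0, 1, 0; 0, 0, 0, 1] ∧
      MatConj Ainf !![β, 0, 0, 0; 0, β, 0, 0; 0, 0, β⁻¹, 0; 0, 0, 0, β⁻¹] ∧
      MatIrred {A0, A1, A4, Ainf} ∧
      ∃ S : Matrix (Fin 4) (Fin 4) ℂ, IsUnit S ∧ Sᵀ = -S ∧
        ∀ A ∈ ({A0, A1, A4, Ainf} : Set (Matrix (Fin 4) (Fin 4) ℂ)), Aᵀ * S * A = S := by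
  have h0 : β ≠ 0 := hβ ▸ Complex.exp_ne_zero _
  have hsq : β ^ 2 ≠ 1 := hβ ▸ exp_sq_ne_one hb
  have hne : 1 + β ≠ 0 := fun h => hsq (by linear_combination (β - 1) * h)
  have hmid : (middle β)ᵀ * form * middle β = form :=
    preserves_mul (preserves_mul (transvection_preserves _ _) (diagPair_preserves (inv_ne_zero h0)))
      (transvection_preserves _ _)
  have hunit : ∀ c x, IsUnit (symTransvection c x) := fun c x =>
    .of_mul_eq_one _ (transvection_mul_neg c x)
  have hdiag : ∀ γ : ℂ, γ ≠ 0 → IsUnit (diagPair γ) := fun γ hγ =>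
    .of_mul_eq_one _ (diagPair_mul_diagPair_inv hγ)
  refine ⟨symTransvection (1 + β)⁻¹ (u β), middle β, symTransvection (1 + β)⁻¹ (w β), diagPair β,
    hunit _ _, ((hunit _ _).mul (hdiag _ (inv_ne_zero h0))).mul (hunit _ _), hunit _ _,
    hdiag _ h0, product_eq_one h0, matConj_transvection_u hne, matConj_transvection_w hne,
    matConj_middle h0 hne, .of_mul_eq_mul 1 (by simp) (by simp [diagPair]), fun W hW => ?_,
    form, (Matrix.isUnit_iff_isUnit_det _).2 (by simp [form_det]), form_transpose, ?_⟩
  · exact eq_bot_or_eq_top h0 hsq (inv_ne_zero hne) (hW _ (by simp)) (hW _ (by simp))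
      (hW _ (by simp))
  · rintro A (rfl | rfl | rfl | rfl)
    · exact transvection_preserves _ _
    · exact hmid
    · exact transvection_preserves _ _
    · exact diagPair_preserves h0
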